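/- arXiv:2003.00815 — 5 statements merged into one kernel-verified Lean document; each statement's English description precedes it below -/
import Mathlib

section
/- Weil's decomposition (existence): For every g ∈ GL₂(K_∞) there exist a non-negative integer r, a matrix γ ∈ GL₂(A), a scalar z ∈ K_∞^×, and κ ∈ GL₂(O_∞) such that g = γ · diag(θ^r, 1) · z · κ. -/
open Polynomial Matrix

noncomputable section

namespace SturmFF

variable (Fq : Type) [Field Fq] [Fintype Fq]

/-- The local field `K_∞ = 𝔽_q((π_∞))`. -/
abbrev Kinf := LaurentSeries Fq

/-- The uniformizer `π_∞`. -/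
def piInf : Kinf Fq := HahnSeries.single 1 1

/-- The element `θ = π_∞⁻¹` of `K_∞`. -/
def thetaK : Kinf Fq := HahnSeries.single (-1) 1

/-- The embedding `A = 𝔽_q[θ] → K_∞` sending `θ` to `π_∞⁻¹`. -/
def polyToK : Polynomial Fq →+* Kinf Fq := (Polynomial.aeval (thetaK Fq)).toRingHom

/-- Membership in the valuation ring `O_∞ = 𝔽_q[[π_∞]]`. -/
def memO (x : Kinf Fq) : Prop := ∀ n : ℤ, n < 0 → x.coeff n = 0

/-- A matrix has all entries in `O_∞`. -/
def MatO (κ : Matrix (Fin 2) (Fin 2) (Kinf Fq)) : Prop := ∀ i j, memO Fq (κ i j)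

/-- Membership in `GL₂(O_∞)`: entries in `O_∞` and determinant a unit of `O_∞`. -/
def InGLO (κ : Matrix (Fin 2) (Fin 2) (Kinf Fq)) : Prop :=
  MatO Fq κ ∧ κ.det.coeff 0 ≠ 0

/-- Membership in the Iwahori subgroup `I_∞ ⊆ GL₂(O_∞)`. -/
def InIw (κ : Matrix (Fin 2) (Fin 2) (Kinf Fq)) : Prop :=
  InGLO Fq κ ∧ ∀ n : ℤ, n < 1 → (κ 1 0).coeff n = 0

/-- The matrix `diag(θ^r, 1)`. -/
def Dmat (r : ℕ) : Matrix (Fin 2) (Fin 2) (Kinf Fq) := !![thetaK Fq ^ r, 0; 0, 1]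

/-- The matrix `(0, 1; π_∞, 0)`. -/
def Jmat : Matrix (Fin 2) (Fin 2) (Kinf Fq) := !![0, 1; piInf Fq, 0]

/-- The Atkin–Lehner/Fricke matrix `w_𝔫 = (0, -1; 𝔫, 0)`. -/
def wmat (𝔫 : Polynomial Fq) : Matrix (Fin 2) (Fin 2) (Kinf Fq) :=
  !![0, -1; polyToK Fq 𝔫, 0]

/-- Membership in the Hecke congruence subgroup `Γ₀(𝔫) ⊆ GL₂(A)`. -/
def InGamma0 (𝔫 : Polynomial Fq) (γ : Matrix (Fin 2) (Fin 2) (Polynomial Fq)) : Prop :=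
  IsUnit γ.det ∧ 𝔫 ∣ γ 1 0

/-- A `Γ₀(𝔫)`-invariant harmonic cochain, viewed as a function on `GL₂(K_∞)`
(encoded as a function on all matrices, with the conditions imposed on invertible ones). -/
def Harmonic (𝔫 : Polynomial Fq) (f : Matrix (Fin 2) (Fin 2) (Kinf Fq) → ℂ) : Prop :=
  (∀ g : Matrix (Fin 2) (Fin 2) (Kinf Fq), g.det ≠ 0 →
    ∀ γ : Matrix (Fin 2) (Fin 2) (Polynomial Fq), InGamma0 Fq 𝔫 γ →
    ∀ z : Kinf Fq, z ≠ 0 → ∀ κ : Matrix (Fin 2) (Fin 2) (Kinf Fq), InIw Fq κ →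
      f (γ.map (polyToK Fq) * g * (z • (1 : Matrix (Fin 2) (Fin 2) (Kinf Fq))) * κ) = f g)
  ∧ (∀ g : Matrix (Fin 2) (Fin 2) (Kinf Fq), g.det ≠ 0 → f (g * Jmat Fq) = - f g)
  ∧ (∀ g : Matrix (Fin 2) (Fin 2) (Kinf Fq), g.det ≠ 0 →
      (∑ ε : Fq, f (g * !![1, 0; polyToK Fq (Polynomial.C ε), 1])) + f (g * !![0, 1; 1, 0]) = 0)

/-- A harmonic cochain is cuspidal if it is finitely supported modulo
`Γ₀(𝔫)` on the left and `K_∞^× I_∞` on the right. -/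
def Cuspidal (𝔫 : Polynomial Fq) (f : Matrix (Fin 2) (Fin 2) (Kinf Fq) → ℂ) : Prop :=
  ∃ S : Finset (Matrix (Fin 2) (Fin 2) (Kinf Fq)),
    ∀ g : Matrix (Fin 2) (Fin 2) (Kinf Fq), g.det ≠ 0 → f g ≠ 0 →
      ∃ s ∈ S, ∃ γ : Matrix (Fin 2) (Fin 2) (Polynomial Fq), InGamma0 Fq 𝔫 γ ∧
        ∃ z : Kinf Fq, z ≠ 0 ∧ ∃ κ : Matrix (Fin 2) (Fin 2) (Kinf Fq), InIw Fq κ ∧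
          g = γ.map (polyToK Fq) * s * (z • (1 : Matrix (Fin 2) (Fin 2) (Kinf Fq))) * κ

/-- The additive character `ψ` of `K_∞`. -/
def psi (x : Kinf Fq) : ℂ :=
  letI := ZMod.algebra Fq (ringChar Fq)
  Complex.exp (2 * Real.pi * Complex.I *
    ((Algebra.trace (ZMod (ringChar Fq)) Fq (x.coeff 1)).val : ℂ) / (ringChar Fq : ℂ))

/-- The constant Fourier coefficient `c₀(f)`. -/
def c0 (f : Matrix (Fin 2) (Fin 2) (Kinf Fq) → ℂ) : ℂ :=
  (Fintype.card Fq : ℂ)⁻¹ *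
    ∑ c : Fq, f !![piInf Fq ^ 2, polyToK Fq (Polynomial.C c) * piInf Fq; 0, 1]

/-- The element `u = Σ_{i=1}^{d+1} c_i π_∞^i` of `K_∞` attached to a tuple of coefficients. -/
def uOf (d : ℕ) (c : Fin (d + 1) → Fq) : Kinf Fq :=
  ∑ i : Fin (d + 1), HahnSeries.single ((i : ℤ) + 1) (c i)

/-- The Fourier coefficient `c_𝔪(f)` for a monic polynomial `𝔪`. -/
def cm (𝔪 : Polynomial Fq) (f : Matrix (Fin 2) (Fin 2) (Kinf Fq) → ℂ) : ℂ :=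
  (Fintype.card Fq : ℂ)⁻¹ *
    ∑ c : Fin (𝔪.natDegree + 1) → Fq,
      f !![piInf Fq ^ (𝔪.natDegree + 2), uOf Fq 𝔪.natDegree c; 0, 1] *
        psi Fq (-(polyToK Fq 𝔪 * uOf Fq 𝔪.natDegree c))

/-- `δ_𝔫(c,d)`: the least `m` such that some `x, y` of degree at most `m`
satisfy `gcd(cx + dy, 𝔫) = 1`. -/
def deltaN (𝔫 c d : Polynomial Fq) : ℕ :=
  sInf { m : ℕ | ∃ x y : Polynomial Fq, x.degree ≤ (m : WithBot ℕ) ∧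
    y.degree ≤ (m : WithBot ℕ) ∧ IsCoprime (c * x + d * y) 𝔫 }

open Classical in
/-- `ε_𝔫(c,d) ∈ {0,1}`. -/
def epsN (𝔫 c d : Polynomial Fq) : ℕ :=
  if ∃ x₀ y₀ : Polynomial Fq, y₀.degree < x₀.degree ∧
      x₀.degree = (deltaN Fq 𝔫 c d : WithBot ℕ) ∧ IsCoprime (c * x₀ + d * y₀) 𝔫
  then 0 else 1

/-- The set `S(c,d;m)`. -/
def Sset (c d : Polynomial Fq) (m : ℕ) : Set (Polynomial Fq) :=
  { z | ∃ x y : Polynomial Fq, x.degree ≤ (m : WithBot ℕ) ∧ y.degree ≤ (m : WithBot ℕ) ∧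
      z = x * c + y * d }

/-- `t(c,d;m)`: the largest cardinality of a pairwise-coprime subset of `S(c,d;m)`. -/
def tcd (c d : Polynomial Fq) (m : ℕ) : ℕ :=
  sSup { n : ℕ | ∃ S' : Finset (Polynomial Fq), ↑S' ⊆ Sset Fq c d m ∧
    (∀ a ∈ S', ∀ b ∈ S', a ≠ b → IsCoprime a b) ∧ S'.card = n }

/-- `t(m,n) ∈ ℕ∞`. -/
def tmn (m n : ℕ) : ℕ∞ :=
  sInf { k : ℕ∞ | ∃ c d : Polynomial Fq, IsCoprime c d ∧
    ((m : WithBot ℕ) + 1) < max c.degree d.degree ∧ max c.degree d.degree < (n : WithBot ℕ) ∧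
    k = (tcd Fq c d m : ℕ∞) }

/-- `t(𝔫)`: the number of distinct monic prime factors of `𝔫`. -/
def tPrimes (𝔫 : Polynomial Fq) : ℕ :=
  Set.ncard { p : Polynomial Fq | p.Monic ∧ Irreducible p ∧ p ∣ 𝔫 }

/-- `τ(𝔫)`. -/
def tauN (𝔫 : Polynomial Fq) : ℕ :=
  sInf { m : ℕ | (tPrimes Fq 𝔫 : ℕ∞) < tmn Fq m 𝔫.natDegree }

section

variable {F : Type} [Field F]

lemma memO_iff_exists_powerSeries {x : Kinf F} :
    memO F x ↔ ∃ f : PowerSeries F, HahnSeries.ofPowerSeries ℤ F f = x := by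
  constructor
  · intro h
    refine ⟨PowerSeries.mk fun n => x.coeff n, ?_⟩
    ext n
    rcases lt_or_ge n 0 with hn | hn
    · rw [h n hn, HahnSeries.ofPowerSeries_apply]
      refine HahnSeries.embDomain_of_notMem_range ?_
      rintro ⟨m, rfl⟩
      simp at hn
      omega
    · lift n to ℕ using hn
      simp
  · rintro ⟨f, rfl⟩ n hn
    rw [HahnSeries.ofPowerSeries_apply]
    refine HahnSeries.embDomain_of_notMem_range ?_
    rintro ⟨m, rfl⟩
    simp at hn
    omega

lemma coeff_zero_ofPowerSeries (f : PowerSeries F) :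
    (HahnSeries.ofPowerSeries ℤ F f).coeff 0 = PowerSeries.constantCoeff f := by
  simpa using HahnSeries.ofPowerSeries_apply_coeff (Γ := ℤ) f 0

lemma memO.mul {x y : Kinf F} (hx : memO F x) (hy : memO F y) : memO F (x * y) := by
  obtain ⟨f, rfl⟩ := memO_iff_exists_powerSeries.1 hx
  obtain ⟨g, rfl⟩ := memO_iff_exists_powerSeries.1 hy
  exact memO_iff_exists_powerSeries.2 ⟨f * g, map_mul _ _ _⟩

lemma memO.add {x y : Kinf F} (hx : memO F x) (hy : memO F y) : memO F (x + y) := by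
  intro n hn
  simp [hx n hn, hy n hn]

lemma memO.neg {x : Kinf F} (hx : memO F x) : memO F (-x) := by
  intro n hn
  simp [hx n hn]

lemma memO_zero : memO F 0 := fun _ _ => by simp

lemma memO_one : memO F 1 := memO_iff_exists_powerSeries.2 ⟨1, map_one _⟩

lemma memO.coeff_zero_mul {x y : Kinf F} (hx : memO F x) (hy : memO F y) :
    (x * y).coeff 0 = x.coeff 0 * y.coeff 0 := by
  obtain ⟨f, rfl⟩ := memO_iff_exists_powerSeries.1 hx
  obtain ⟨g, rfl⟩ := memO_iff_exists_powerSeries.1 hy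
  rw [← map_mul, coeff_zero_ofPowerSeries, coeff_zero_ofPowerSeries, coeff_zero_ofPowerSeries,
    map_mul]

lemma memO_of_order_nonneg {x : Kinf F} (hx : 0 ≤ x.order) : memO F x :=
  fun _ hn => HahnSeries.coeff_eq_zero_of_lt_order (hn.trans_le hx)

lemma order_div {x y : Kinf F} (hx : x ≠ 0) (hy : y ≠ 0) :
    (x / y).order = x.order - y.order := by
  have h := HahnSeries.order_mul (div_ne_zero hx hy) hy
  rw [div_mul_cancel₀ x hy] at h
  omega

lemma memO_div {x y : Kinf F} (hy : y ≠ 0) (h : x = 0 ∨ y.order ≤ x.order) :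
    memO F (x / y) := by
  by_cases hx : x = 0
  · simpa [hx] using memO_zero
  · refine memO_of_order_nonneg ?_
    rw [order_div hx hy]
    have := h.resolve_left hx
    omega

lemma MatO.memO_det {κ : Matrix (Fin 2) (Fin 2) (Kinf F)} (h : MatO F κ) :
    memO F κ.det := by
  rw [Matrix.det_fin_two, sub_eq_add_neg]
  exact ((h 0 0).mul (h 1 1)).add ((h 0 1).mul (h 1 0)).neg

lemma InGLO.mul {κ κ' : Matrix (Fin 2) (Fin 2) (Kinf F)} (h : InGLO F κ) (h' : InGLO F κ') :
    InGLO F (κ * κ') := by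
  refine ⟨fun i j => ?_, ?_⟩
  · rw [Matrix.mul_apply, Fin.sum_univ_two]
    exact ((h.1 i 0).mul (h'.1 0 j)).add ((h.1 i 1).mul (h'.1 1 j))
  · rw [Matrix.det_mul, h.1.memO_det.coeff_zero_mul h'.1.memO_det]
    exact mul_ne_zero h.2 h'.2

lemma matO_of {a b c d : Kinf F} (ha : memO F a) (hb : memO F b) (hc : memO F c)
    (hd : memO F d) : MatO F !![a, b; c, d] := by
  intro i j
  fin_cases i <;> fin_cases j <;> assumption

lemma inGLO_one : InGLO F 1 := by
  rw [Matrix.one_fin_two]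
  exact ⟨matO_of memO_one memO_zero memO_zero memO_one, by simp [Matrix.det_fin_two]⟩

lemma inGLO_swap : InGLO F !![0, 1; 1, 0] :=
  ⟨matO_of memO_zero memO_one memO_one memO_zero, by simp [Matrix.det_fin_two]⟩

lemma inGLO_upper {x : Kinf F} (hx : memO F x) : InGLO F !![1, x; 0, 1] :=
  ⟨matO_of memO_one hx memO_zero memO_one, by simp [Matrix.det_fin_two]⟩

lemma inGLO_lower {x : Kinf F} (hx : memO F x) : InGLO F !![1, 0; x, 1] :=
  ⟨matO_of memO_one memO_zero hx memO_one, by simp [Matrix.det_fin_two]⟩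

lemma inGLO_diag {x : Kinf F} (hx : x ≠ 0) (h : x.order = 0) : InGLO F !![x, 0; 0, 1] := by
  refine ⟨matO_of (memO_of_order_nonneg h.ge) memO_zero memO_zero memO_one, ?_⟩
  simpa [Matrix.det_fin_two, h] using HahnSeries.coeff_order_eq_zero.not.2 hx

lemma thetaK_pow (i : ℕ) : thetaK F ^ i = HahnSeries.single (-(i : ℤ)) 1 := by
  simp [thetaK, HahnSeries.single_pow]

lemma polyToK_monomial (i : ℕ) (c : F) :
    polyToK F (Polynomial.monomial i c) = HahnSeries.single (-(i : ℤ)) c := by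
  have h : polyToK F (Polynomial.monomial i c) = algebraMap F (Kinf F) c * thetaK F ^ i :=
    Polynomial.aeval_monomial _
  have hc : algebraMap F (Kinf F) c = HahnSeries.single 0 c := by
    simp [LaurentSeries.algebraMap_apply]
  rw [h, hc, thetaK_pow, HahnSeries.single_mul_single, zero_add, mul_one]

lemma coeff_polyToK (P : Polynomial F) (i : ℕ) :
    (polyToK F P).coeff (-(i : ℤ)) = P.coeff i := by
  induction P using Polynomial.induction_on' with
  | add p q hp hq => simp [hp, hq]
  | monomial n a =>
    rw [polyToK_monomial, Polynomial.coeff_monomial, HahnSeries.coeff_single]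
    simp [eq_comm]

/-- Every Laurent series is a polynomial in `θ` plus an element of the maximal ideal. -/
lemma exists_polyToK_add (u : Kinf F) :
    ∃ (P : Polynomial F) (v : Kinf F), u = polyToK F P + v ∧ ∀ n : ℤ, n < 1 → v.coeff n = 0 := by
  let P : Polynomial F :=
    ∑ i ∈ Finset.range ((-u.order).toNat + 1), Polynomial.monomial i (u.coeff (-(i : ℤ)))
  refine ⟨P, u - polyToK F P, by ring, fun n hn => ?_⟩
  obtain ⟨i, rfl⟩ : ∃ i : ℕ, n = -(i : ℤ) := ⟨(-n).toNat, by omega⟩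
  rw [HahnSeries.coeff_sub, coeff_polyToK]
  simp only [P, Polynomial.finsetSum_coeff, Polynomial.coeff_monomial, Finset.sum_ite_eq',
    Finset.mem_range]
  split_ifs with h
  · simp
  · rw [sub_zero]
    exact HahnSeries.coeff_eq_zero_of_lt_order (by omega)

/-- `g` has a decomposition `γ · diag(θ^r, 1) · z · κ`. -/
def HasWeilDecomposition (g : Matrix (Fin 2) (Fin 2) (Kinf F)) : Prop :=
  ∃ (r : ℕ) (γ : Matrix (Fin 2) (Fin 2) (Polynomial F)) (z : Kinf F)
    (κ : Matrix (Fin 2) (Fin 2) (Kinf F)),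
    IsUnit γ.det ∧ z ≠ 0 ∧ InGLO F κ ∧
    g = γ.map (polyToK F) * Dmat F r * (z • (1 : Matrix (Fin 2) (Fin 2) (Kinf F))) * κ

namespace HasWeilDecomposition

variable {g : Matrix (Fin 2) (Fin 2) (Kinf F)}

lemma map_mul_left (h : HasWeilDecomposition g) {γ : Matrix (Fin 2) (Fin 2) (Polynomial F)}
    (hγ : IsUnit γ.det) : HasWeilDecomposition (γ.map (polyToK F) * g) := by
  obtain ⟨r, γ', z, κ, hγ', hz, hκ, rfl⟩ := h
  refine ⟨r, γ * γ', z, κ, ?_, hz, hκ, ?_⟩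
  · rw [Matrix.det_mul]
    exact hγ.mul hγ'
  · rw [Matrix.map_mul]
    simp only [Matrix.mul_assoc]

lemma smul (h : HasWeilDecomposition g) {w : Kinf F} (hw : w ≠ 0) :
    HasWeilDecomposition (w • g) := by
  obtain ⟨r, γ, z, κ, hγ, hz, hκ, rfl⟩ := h
  exact ⟨r, γ, w * z, κ, hγ, mul_ne_zero hw hz, hκ, by simp [mul_smul]⟩

lemma mul_right (h : HasWeilDecomposition g) {κ : Matrix (Fin 2) (Fin 2) (Kinf F)}
    (hκ : InGLO F κ) : HasWeilDecomposition (g * κ) := by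
  obtain ⟨r, γ, z, κ', hγ, hz, hκ', rfl⟩ := h
  exact ⟨r, γ, z, κ' * κ, hγ, hz, hκ'.mul hκ, by simp only [Matrix.mul_assoc]⟩

lemma swap_mul (h : HasWeilDecomposition g) : HasWeilDecomposition (!![0, 1; 1, 0] * g) := by
  have h' := h.map_mul_left (γ := !![0, 1; 1, 0]) (by simp [Matrix.det_fin_two])
  have e : (!![0, 1; 1, 0] : Matrix (Fin 2) (Fin 2) (Polynomial F)).map (polyToK F)
      = !![0, 1; 1, 0] := by
    ext i j : 1
    fin_cases i <;> fin_cases j <;> simp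
  rwa [e] at h'

lemma translate {a u : Kinf F} (P : Polynomial F)
    (h : HasWeilDecomposition !![a, u; 0, 1]) :
    HasWeilDecomposition !![a, polyToK F P + u; 0, 1] := by
  have h' := h.map_mul_left (γ := !![1, P; 0, 1]) (by simp [Matrix.det_fin_two])
  have e : (!![1, P; 0, 1] : Matrix (Fin 2) (Fin 2) (Polynomial F)).map (polyToK F)
      = !![1, polyToK F P; 0, 1] := by
    ext i j : 1
    fin_cases i <;> fin_cases j <;> simp
  rw [e] at h'
  simpa [Matrix.mul_fin_two, add_comm] using h'

end HasWeilDecomposition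

lemma hasWeilDecomposition_diag_of_order_nonpos {a : Kinf F} (ha : a ≠ 0) (h : a.order ≤ 0) :
    HasWeilDecomposition !![a, 0; 0, 1] := by
  set r := (-a.order).toNat with hr
  have hθ : thetaK F ^ r ≠ 0 := by simp [thetaK_pow]
  have ho : (thetaK F ^ r).order = a.order := by
    rw [thetaK_pow, HahnSeries.order_single one_ne_zero]
    omega
  refine ⟨r, 1, 1, !![a / thetaK F ^ r, 0; 0, 1], by simp, one_ne_zero,
    inGLO_diag (div_ne_zero ha hθ) (by rw [order_div ha hθ]; omega), ?_⟩
  rw [Matrix.map_one _ (map_zero _) (map_one _)]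
  simp [Dmat, mul_div_cancel₀ _ hθ]

lemma hasWeilDecomposition_diag {a : Kinf F} (ha : a ≠ 0) :
    HasWeilDecomposition !![a, 0; 0, 1] := by
  rcases le_total a.order 0 with h | h
  · exact hasWeilDecomposition_diag_of_order_nonpos ha h
  · have h1 : (a⁻¹).order ≤ 0 := by
      have := order_div one_ne_zero ha
      rw [one_div, HahnSeries.order_one] at this
      omega
    have h2 := (((hasWeilDecomposition_diag_of_order_nonpos (inv_ne_zero ha) h1).smul ha).mul_right
      inGLO_swap).swap_mul
    simpa [Matrix.mul_fin_two, Matrix.smul_of, ha] using h2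

/-- The upper triangular case, by induction on the order of the upper left entry. -/
lemma hasWeilDecomposition_upper {a : Kinf F} (ha : a ≠ 0) (u : Kinf F) :
    HasWeilDecomposition !![a, u; 0, 1] := by
  induction hn : a.order.toNat using Nat.strong_induction_on generalizing a u with
  | _ n ih =>
    obtain ⟨P, v, rfl, hv⟩ := exists_polyToK_add u
    refine HasWeilDecomposition.translate P ?_
    by_cases hva : v = 0 ∨ a.order ≤ v.order
    · have h := (hasWeilDecomposition_diag ha).mul_right (inGLO_upper (memO_div ha hva))
      simpa [Matrix.mul_fin_two, mul_div_cancel₀ _ ha] using h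
    · push Not at hva
      obtain ⟨hv0, hlt⟩ := hva
      have hv1 : 1 ≤ v.order := by
        by_contra! hlt1
        exact HahnSeries.coeff_order_eq_zero.not.2 hv0 (hv _ hlt1)
      have ho : (-a / v / v).order = a.order - v.order - v.order := by
        rw [order_div (div_ne_zero (neg_ne_zero.2 ha) hv0) hv0, order_div (neg_ne_zero.2 ha) hv0,
          HahnSeries.order_neg]
      have h := ih _ (by rw [ho]; omega)
        (div_ne_zero (div_ne_zero (neg_ne_zero.2 ha) hv0) hv0) (1 / v) rfl
      have h' := ((h.smul hv0).mul_right (inGLO_lower (memO_div hv0 (.inr hlt.le)))).swap_mul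
      convert h' using 1
      simp only [Matrix.smul_of, Matrix.mul_fin_two, Matrix.smul_cons, Matrix.smul_empty,
        smul_eq_mul]
      ext i j : 1
      fin_cases i <;> fin_cases j <;> simp <;> field_simp
      ring

lemma hasWeilDecomposition_of_order_le {a b c d : Kinf F} (hdet : a * d - b * c ≠ 0)
    (hd : d ≠ 0) (h : c = 0 ∨ d.order ≤ c.order) : HasWeilDecomposition !![a, b; c, d] := by
  have h' := ((hasWeilDecomposition_upper (div_ne_zero (div_ne_zero hdet hd) hd) (b / d)).smul
    hd).mul_right (inGLO_lower (memO_div hd h))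
  convert h' using 1
  ext i j : 1
  fin_cases i <;> fin_cases j <;> simp [Matrix.mul_apply, Fin.sum_univ_two] <;> field_simp
  ring

end

/-- **Weil decomposition, existence**: every `g ∈ GL₂(K_∞)` can be written as
`γ · diag(θ^r, 1) · z · κ` with `r ≥ 0`, `γ ∈ GL₂(A)`, `z ∈ K_∞^×`, `κ ∈ GL₂(O_∞)`. -/
theorem weil_decomposition_existence
    (Fq : Type) [Field Fq] [Fintype Fq]
    (g : Matrix (Fin 2) (Fin 2) (Kinf Fq)) (hg : g.det ≠ 0) :
    ∃ (r : ℕ) (γ : Matrix (Fin 2) (Fin 2) (Polynomial Fq)) (z : Kinf Fq)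
      (κ : Matrix (Fin 2) (Fin 2) (Kinf Fq)),
      IsUnit γ.det ∧ z ≠ 0 ∧ InGLO Fq κ ∧
      g = γ.map (polyToK Fq) * Dmat Fq r *
            (z • (1 : Matrix (Fin 2) (Fin 2) (Kinf Fq))) * κ := by
  suffices h : HasWeilDecomposition g from h
  obtain ⟨a, b, c, d, rfl⟩ : ∃ a b c d : Kinf Fq, g = !![a, b; c, d] :=
    ⟨_, _, _, _, Matrix.eta_fin_two g⟩
  rw [Matrix.det_fin_two_of] at hg
  by_cases h : d ≠ 0 ∧ (c = 0 ∨ d.order ≤ c.order)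
  · exact hasWeilDecomposition_of_order_le hg h.1 h.2
  · have hc : c ≠ 0 := by
      rintro rfl
      refine h ⟨?_, .inl rfl⟩
      rintro rfl
      simp at hg
    have hdc : d = 0 ∨ c.order ≤ d.order := by
      by_contra! hcon
      exact h ⟨hcon.1, .inr hcon.2.le⟩
    have h' := (hasWeilDecomposition_of_order_le (a := b) (b := a) (c := d) (d := c)
      (fun h0 => hg (by linear_combination -h0)) hc hdc).mul_right inGLO_swap
    simpa [Matrix.mul_fin_two] using h'
end SturmFF
end
end

section
/- Distance formula on the Bruhat–Tits tree (elementary-divisor form): Let γ ∈ GL₂(A) with entries a, b, c, d, and set h := max(deg a, deg b, deg c, deg d), a non-negative integer. Then there exist κ₁, κ₂ ∈ GL₂(O_∞) such that γ = κ₁ · diag(π_∞^{−h}, π_∞^{h}) · κ₂. (Equivalently, the distance between the standard vertex v₀ and γ·v₀ on the Bruhat–Tits tree of PGL₂(K_∞) equals 2·max(deg a, deg b, deg c, deg d).) -/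
open Polynomial Matrix

noncomputable section

namespace SturmFF

variable (Fq : Type) [Field Fq] [Fintype Fq]

section

variable {F : Type} [Field F]

lemma memO_coe (y : PowerSeries F) : memO F (y : Kinf F) := by
  intro n hn
  rw [PowerSeries.coeff_coe, if_pos hn]

lemma coeff_zero_coe (y : PowerSeries F) :
    (y : Kinf F).coeff 0 = PowerSeries.constantCoeff y := by
  simp [PowerSeries.coeff_coe]

lemma piInf_ne_zero : piInf F ≠ 0 := by
  simp [piInf]

lemma piInf_mul_thetaK : piInf F * thetaK F = 1 := by
  simp [piInf, thetaK]

/-- A polynomial of degree at most `h` becomes, after multiplication by `π_∞ ^ h`, a power series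
whose constant coefficient is the coefficient of degree `h`. -/
lemma exists_polyToK_mul_piInf_pow (h : ℕ) (p : Polynomial F) (hp : p.degree ≤ h) :
    ∃ y : PowerSeries F, polyToK F p * piInf F ^ h = y ∧
      PowerSeries.constantCoeff y = p.coeff h := by
  refine ⟨((p.reflect h : Polynomial F) : PowerSeries F), ?_, ?_⟩
  · let _ : Invertible (piInf F) :=
      ⟨thetaK F, by rw [mul_comm, piInf_mul_thetaK], piInf_mul_thetaK⟩
    have key := eval₂_reflect_mul_pow (algebraMap F (Kinf F)) (piInf F) h (p.reflect h)
      ((natDegree_reflect_le).trans (max_le le_rfl (natDegree_le_of_degree_le hp)))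
    have hrefl : (p.reflect h).reflect h = p := by
      ext n
      rw [coeff_reflect, coeff_reflect, revAt_invol]
    rw [hrefl] at key
    have hr : ∀ q : Polynomial F,
        eval₂ (algebraMap F (Kinf F)) (piInf F) q = ((q : PowerSeries F) : Kinf F) := by
      intro q
      induction q using Polynomial.induction_on' with
      | add p q hp hq => simp [eval₂_add, hp, hq]
      | monomial n a =>
        rw [eval₂_monomial, ← C_mul_X_pow_eq_monomial]
        simp [piInf, HahnSeries.algebraMap_apply']
    rw [← hr]
    exact key
  · rw [← PowerSeries.coeff_zero_eq_constantCoeff_apply, Polynomial.coeff_coe, coeff_reflect]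
    simp [revAt_le]

/-- The decomposition when the top left entry has maximal degree. -/
lemma exists_decomposition_of_coeff_ne_zero
    (γ : Matrix (Fin 2) (Fin 2) (Polynomial F)) (hγ : IsUnit γ.det) (h : ℕ)
    (hle : ∀ i j, (γ i j).degree ≤ h) (h0 : (γ 0 0).coeff h ≠ 0) :
    ∃ κ₁ κ₂ : Matrix (Fin 2) (Fin 2) (Kinf F), InGLO F κ₁ ∧ InGLO F κ₂ ∧
      γ.map (polyToK F) =
        κ₁ * !![piInf F ^ (-(h : ℤ)), 0; 0, piInf F ^ (h : ℤ)] * κ₂ := by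
  choose N hN hN0 using fun i j => exists_polyToK_mul_piInf_pow h (γ i j) (hle i j)
  obtain ⟨c, hc, hcdet⟩ := Polynomial.isUnit_iff.mp hγ
  have hu : PowerSeries.constantCoeff (N 0 0) ≠ 0 := by rwa [hN0]
  have hv := PowerSeries.mul_inv_cancel (N 0 0) hu
  set v := (N 0 0)⁻¹
  have hvK : (N 0 0 : Kinf F) * (v : Kinf F) = 1 := by
    rw [← PowerSeries.coe_mul, hv, PowerSeries.coe_one]
  have hP := pow_ne_zero h (piInf_ne_zero (F := F))
  set P := piInf F ^ h with hPdef
  have hγN : ∀ i j, polyToK F (γ i j) = P⁻¹ * N i j := fun i j => by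
    rw [← hN]; field_simp
  have hdet : (N 0 0 : Kinf F) * N 1 1 - N 0 1 * N 1 0 =
      ((PowerSeries.C c : PowerSeries F) : Kinf F) * P ^ 2 := by
    have := congrArg (polyToK F) hcdet
    rw [det_fin_two, map_sub, map_mul, map_mul] at this
    have hC : polyToK F (C c) = ((PowerSeries.C c : PowerSeries F) : Kinf F) := by
      simp [polyToK, HahnSeries.algebraMap_apply']
    rw [← hN, ← hN, ← hN, ← hN, ← hC, this]
    ring
  refine ⟨!![(N 0 0 : Kinf F), 0; (N 1 0 : Kinf F),
      ((PowerSeries.C c * v : PowerSeries F) : Kinf F)],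
    !![((1 : PowerSeries F) : Kinf F), ((N 0 1 * v : PowerSeries F) : Kinf F);
      0, ((1 : PowerSeries F) : Kinf F)], ⟨?_, ?_⟩, ⟨?_, ?_⟩, ?_⟩
  · intro i j
    fin_cases i <;> fin_cases j
    exacts [memO_coe _, fun _ _ => rfl, memO_coe _, memO_coe _]
  · have : (N 0 0 : Kinf F) * ((PowerSeries.C c * v : PowerSeries F) : Kinf F) =
        ((PowerSeries.C c : PowerSeries F) : Kinf F) := by
      rw [PowerSeries.coe_mul, mul_left_comm, hvK, mul_one]
    rw [det_fin_two_of, this, zero_mul, sub_zero, coeff_zero_coe, PowerSeries.constantCoeff_C]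
    exact hc.ne_zero
  · intro i j
    fin_cases i <;> fin_cases j
    exacts [memO_coe _, memO_coe _, fun _ _ => rfl, memO_coe _]
  · simp [det_fin_two_of]
  · rw [_root_.zpow_neg, zpow_natCast, ← hPdef]
    ext1 i j
    fin_cases i <;> fin_cases j
    · simp [hγN, Matrix.mul_apply, Fin.sum_univ_two]
      ring
    · simp [hγN, Matrix.mul_apply, Fin.sum_univ_two]
      linear_combination (-P⁻¹ * N 0 1) * hvK
    · simp [hγN, Matrix.mul_apply, Fin.sum_univ_two]
      ring
    · simp only [PowerSeries.coe_mul, PowerSeries.coe_one]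
      simp [hγN, Matrix.mul_apply, Fin.sum_univ_two, -HahnSeries.ofPowerSeries_C]
      field_simp
      linear_combination (v : Kinf F) * hdet - (N 1 1 : Kinf F) * hvK

lemma InGLO.submatrix {κ : Matrix (Fin 2) (Fin 2) (Kinf F)} (hκ : InGLO F κ)
    (e : Equiv.Perm (Fin 2)) :
    InGLO F (κ.submatrix e id) ∧ InGLO F (κ.submatrix id e) := by
  have hs : ((Equiv.Perm.sign e : ℤ) : Kinf F) * κ.det = κ.det ∨
      ((Equiv.Perm.sign e : ℤ) : Kinf F) * κ.det = -κ.det := by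
    rcases Int.units_eq_one_or (Equiv.Perm.sign e) with h | h <;> simp [h]
  refine ⟨⟨fun i j => hκ.1 _ _, ?_⟩, ⟨fun i j => hκ.1 _ _, ?_⟩⟩
  · rw [det_permute]
    rcases hs with h | h <;> rw [h] <;> simpa using hκ.2
  · rw [det_permute']
    rcases hs with h | h <;> rw [h] <;> simpa using hκ.2

end

/-- **Distance formula on the Bruhat–Tits tree** (elementary-divisor form):
`γ = κ₁ · diag(π_∞^{-h}, π_∞^{h}) · κ₂` with `h = max` of the degrees of the entries. -/
theorem distance_formula
    (Fq : Type) [Field Fq] [Fintype Fq]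
    (γ : Matrix (Fin 2) (Fin 2) (Polynomial Fq)) (hγ : IsUnit γ.det)
    (h : ℕ)
    (hh : (h : WithBot ℕ) =
      max (max (γ 0 0).degree (γ 0 1).degree) (max (γ 1 0).degree (γ 1 1).degree)) :
    ∃ κ₁ κ₂ : Matrix (Fin 2) (Fin 2) (Kinf Fq), InGLO Fq κ₁ ∧ InGLO Fq κ₂ ∧
      γ.map (polyToK Fq) =
        κ₁ * !![piInf Fq ^ (-(h : ℤ)), 0; 0, piInf Fq ^ (h : ℤ)] * κ₂ := by
  have hle : ∀ i j, (γ i j).degree ≤ h := by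
    rw [hh]
    intro i j
    fin_cases i <;> fin_cases j <;> simp
  obtain ⟨i, j, hij⟩ : ∃ i j, (γ i j).degree = h := by
    rcases max_choice (max (γ 0 0).degree (γ 0 1).degree) (max (γ 1 0).degree (γ 1 1).degree)
      with h₁ | h₁ <;> rw [h₁] at hh
    · rcases max_choice (γ 0 0).degree (γ 0 1).degree with h₂ | h₂ <;> rw [h₂] at hh
      exacts [⟨0, 0, hh.symm⟩, ⟨0, 1, hh.symm⟩]
    · rcases max_choice (γ 1 0).degree (γ 1 1).degree with h₂ | h₂ <;> rw [h₂] at hh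
      exacts [⟨1, 0, hh.symm⟩, ⟨1, 1, hh.symm⟩]
  set e := Equiv.swap 0 i
  set f := Equiv.swap 0 j
  have hdet : IsUnit (γ.submatrix e f).det := by
    have : γ.submatrix e f = (γ.submatrix e id).submatrix id f := rfl
    rw [this, det_permute', det_permute]
    exact ((Equiv.Perm.sign f).isUnit.map (Int.castRingHom _)).mul
      (((Equiv.Perm.sign e).isUnit.map (Int.castRingHom _)).mul hγ)
  obtain ⟨κ₁, κ₂, h₁, h₂, hκ⟩ := exists_decomposition_of_coeff_ne_zero (γ.submatrix e f) hdet h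
    (fun _ _ => hle _ _) (by
      simpa [e, f] using coeff_ne_zero_of_eq_degree hij)
  refine ⟨κ₁.submatrix e id, κ₂.submatrix id f, (h₁.submatrix e).1, (h₂.submatrix f).2, ?_⟩
  ext1 k l
  have := congrFun (congrFun hκ (e k)) (f l)
  simpa [e, f, Matrix.mul_apply] using this

end SturmFF
end
end

section
/- Comparison of δ_𝔫 with τ(𝔫): Let 𝔫 ∈ A₊ and let c, d ∈ A be coprime with max(deg c, deg d) < deg 𝔫. Then δ_𝔫(c,d) ≤ τ(𝔫); consequently 2·δ_𝔫(c,d) + ε_𝔫(c,d) ≤ 2·τ(𝔫) + 1. -/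
open Polynomial Matrix

noncomputable section

namespace SturmFF

variable (Fq : Type) [Field Fq] [Fintype Fq]

theorem finite_monic_irreducible_factors {K : Type*} [Field K] {f : K[X]} (hf : f ≠ 0) :
    { p : K[X] | p.Monic ∧ Irreducible p ∧ p ∣ f }.Finite := by
  classical
  refine (UniqueFactorizationMonoid.normalizedFactors f).toFinset.finite_toSet.subset ?_
  rintro p ⟨hp, hirr, hdvd⟩
  exact Finset.mem_coe.2 <| Multiset.mem_toFinset.2 <|
    (UniqueFactorizationMonoid.mem_normalizedFactors_iff' hf).2
      ⟨hirr, hp.normalize_eq_self, hdvd⟩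

theorem exists_monic_irreducible_dvd_of_not_isCoprime {K : Type*} [Field K] {a f : K[X]}
    (hf : f ≠ 0) (h : ¬ IsCoprime a f) :
    ∃ p : K[X], (p.Monic ∧ Irreducible p ∧ p ∣ f) ∧ p ∣ a := by
  classical
  by_contra! hne
  refine h (isCoprime_of_irreducible_dvd (fun h => hf h.2) fun z hz hza hzf => ?_)
  exact hne (normalize z) ⟨monic_normalize hz.ne_zero,
    (associated_normalize z).irreducible hz, normalize_dvd_iff.2 hzf⟩ (normalize_dvd_iff.2 hza)

/-- A finite set of pairwise coprime polynomials with more elements than `f` has monic prime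
factors contains a polynomial coprime to `f`. -/
theorem exists_isCoprime_of_tPrimes_lt_card {K : Type} [Field K] {f : K[X]} (hf : f ≠ 0)
    (S : Finset K[X]) (hS : ∀ a ∈ S, ∀ b ∈ S, a ≠ b → IsCoprime a b)
    (hcard : tPrimes K f < S.card) :
    ∃ a ∈ S, IsCoprime a f := by
  by_contra! hne
  have key : ∀ a : S, ∃ p : K[X], (p.Monic ∧ Irreducible p ∧ p ∣ f) ∧ p ∣ a.1 := fun a =>
    exists_monic_irreducible_dvd_of_not_isCoprime hf (hne a.1 a.2)
  choose g hg hga using key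
  have hinj : Function.Injective g := by
    intro a b hab
    by_contra hab'
    have hcop := hS a.1 a.2 b.1 b.2 fun h => hab' (Subtype.ext h)
    exact (hg a).2.1.not_isUnit (hcop.isUnit_of_dvd' (hga a) (hab ▸ hga b))
  have hle : (Set.range g).ncard ≤ tPrimes K f :=
    Set.ncard_le_ncard (Set.range_subset_iff.2 hg) (finite_monic_irreducible_factors hf)
  rw [← Set.image_univ, Set.ncard_image_of_injective _ hinj, Set.ncard_univ,
    Nat.card_eq_fintype_card, Fintype.card_coe] at hle
  omega

/-- Coprime polynomials of degree at most `m + 1` admit Bézout coefficients of degree at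
most `m`. -/
theorem exists_bezout_natDegree_le {K : Type*} [Field K] {c d : K[X]} (hcd : IsCoprime c d)
    {m : ℕ} (hc : c.natDegree ≤ m + 1) (hd : d.natDegree ≤ m + 1) :
    ∃ x y : K[X], x.natDegree ≤ m ∧ y.natDegree ≤ m ∧ c * x + d * y = 1 := by
  by_cases hcu : IsUnit c
  · obtain ⟨u, hu⟩ := hcu.exists_right_inv
    refine ⟨u, 0, ?_, by simp, by simp [hu]⟩
    simp [natDegree_eq_zero_of_isUnit (IsUnit.of_mul_eq_one_right c hu)]
  by_cases hdu : IsUnit d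
  · obtain ⟨u, hu⟩ := hdu.exists_right_inv
    refine ⟨0, u, by simp, ?_, by simp [hu]⟩
    simp [natDegree_eq_zero_of_isUnit (IsUnit.of_mul_eq_one_right d hu)]
  have hc0 : c ≠ 0 := by
    rintro rfl
    exact hdu (isCoprime_zero_left.1 hcd)
  have hd0 : d ≠ 0 := by
    rintro rfl
    exact hcu (isCoprime_zero_right.1 hcd)
  have hcpos : 0 < c.natDegree :=
    natDegree_pos_iff_degree_pos.2 (degree_pos_of_ne_zero_of_nonunit hc0 hcu)
  have hdpos : 0 < d.natDegree :=
    natDegree_pos_iff_degree_pos.2 (degree_pos_of_ne_zero_of_nonunit hd0 hdu)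
  obtain ⟨u, v, huv⟩ := hcd
  have hx : (u % d).natDegree < d.natDegree := natDegree_mod_lt u hdpos.ne'
  have hbez : c * (u % d) + d * (v + u / d * c) = 1 := by
    linear_combination huv + c * EuclideanDomain.mod_add_div u d
  refine ⟨u % d, v + u / d * c, by omega, ?_, hbez⟩
  generalize v + u / d * c = y at hbez ⊢
  by_cases hy : y = 0
  · simp [hy]
  have hdy : (d * y).natDegree ≤ max 0 (c.natDegree + (u % d).natDegree) := by
    rw [show d * y = 1 - c * (u % d) by linear_combination hbez]
    refine (natDegree_sub_le _ _).trans ?_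
    rw [natDegree_one]
    exact max_le_max le_rfl natDegree_mul_le
  rw [natDegree_mul hd0 hy] at hdy
  omega

theorem exists_isCoprime_of_tPrimes_lt_tmn {K : Type} [Field K] {f c d : K[X]}
    (hf : f ≠ 0) (hcd : IsCoprime c d)
    (hdeg : max c.degree d.degree < (f.natDegree : WithBot ℕ)) {m : ℕ}
    (hm : (tPrimes K f : ℕ∞) < tmn K m f.natDegree) :
    ∃ x y : K[X], x.degree ≤ (m : WithBot ℕ) ∧ y.degree ≤ (m : WithBot ℕ) ∧
      IsCoprime (c * x + d * y) f := by
  by_cases hk : ((m : WithBot ℕ) + 1) < max c.degree d.degree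
  · have ht : tPrimes K f < tcd K c d m := by
      exact_mod_cast hm.trans_le (sInf_le ⟨c, d, hcd, hk, hdeg, rfl⟩)
    obtain ⟨_, ⟨S, hS, hcop, rfl⟩, hlt⟩ :=
      exists_lt_of_lt_csSup (by exact ⟨0, ∅, by simp, by simp, rfl⟩) ht
    obtain ⟨a, haS, ha⟩ := exists_isCoprime_of_tPrimes_lt_card hf S hcop hlt
    obtain ⟨x, y, hx, hy, rfl⟩ := hS haS
    exact ⟨x, y, hx, hy, by rwa [mul_comm c, mul_comm d]⟩
  · have hk' : max c.degree d.degree ≤ ((m + 1 : ℕ) : WithBot ℕ) := by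
      simpa using not_lt.1 hk
    obtain ⟨x, y, hx, hy, hxy⟩ := exists_bezout_natDegree_le hcd
      (natDegree_le_of_degree_le ((le_max_left _ _).trans hk'))
      (natDegree_le_of_degree_le ((le_max_right _ _).trans hk'))
    exact ⟨x, y, degree_le_of_natDegree_le hx, degree_le_of_natDegree_le hy,
      hxy ▸ isCoprime_one_left⟩

theorem tPrimes_lt_tmn_tauN {K : Type} [Field K] (f : K[X]) :
    (tPrimes K f : ℕ∞) < tmn K (tauN K f) f.natDegree := by
  refine Nat.sInf_mem (s := { m : ℕ | (tPrimes K f : ℕ∞) < tmn K m f.natDegree })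
    ⟨f.natDegree, ?_⟩
  have htop : tmn K f.natDegree f.natDegree = ⊤ := by
    refine sInf_eq_top.2 ?_
    rintro _ ⟨c, d, -, h₁, h₂, -⟩
    have h : ((f.natDegree + 1 : ℕ) : WithBot ℕ) < (f.natDegree : WithBot ℕ) := by
      simpa using h₁.trans h₂
    exact absurd (Nat.cast_lt.1 h) (by omega)
  simp [htop]

theorem epsN_le_one {K : Type} [Field K] (f c d : K[X]) : epsN K f c d ≤ 1 := by
  unfold epsN
  split_ifs <;> omega

/-- **Comparison of `δ_𝔫` with `τ(𝔫)`**: if `c, d` are coprime with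
`max(deg c, deg d) < deg 𝔫`, then `δ_𝔫(c,d) ≤ τ(𝔫)` and
`2·δ_𝔫(c,d) + ε_𝔫(c,d) ≤ 2·τ(𝔫) + 1`. -/
theorem delta_le_tau
    (Fq : Type) [Field Fq] [Fintype Fq]
    (𝔫 : Polynomial Fq) (h𝔫 : 𝔫.Monic)
    (c d : Polynomial Fq) (hcd : IsCoprime c d)
    (hdeg : max c.degree d.degree < (𝔫.natDegree : WithBot ℕ)) :
    deltaN Fq 𝔫 c d ≤ tauN Fq 𝔫 ∧
      2 * deltaN Fq 𝔫 c d + epsN Fq 𝔫 c d ≤ 2 * tauN Fq 𝔫 + 1 := by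
  have hδ : deltaN Fq 𝔫 c d ≤ tauN Fq 𝔫 := Nat.sInf_le
    (exists_isCoprime_of_tPrimes_lt_tmn h𝔫.ne_zero hcd hdeg (tPrimes_lt_tmn_tauN 𝔫))
  have hε := epsN_le_one 𝔫 c d
  exact ⟨hδ, by omega⟩
end SturmFF
end
end

section
/- For every integer n ≥ 3, one has t(0, n) = q + 1. -/
open Polynomial Matrix

noncomputable section

namespace SturmFF

variable (Fq : Type) [Field Fq] [Fintype Fq]

/-- Elements of `S(c,d;0)` are the `𝔽_q`-linear combinations of `c` and `d`. -/
theorem mem_Sset_zero {F : Type} [Field F] {c d z : Polynomial F} :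
    z ∈ Sset F c d 0 ↔ ∃ x y : F, z = C x * c + C y * d := by
  constructor
  · rintro ⟨x, y, hx, hy, rfl⟩
    exact ⟨x.coeff 0, y.coeff 0, by
      rw [← eq_C_of_degree_le_zero (by simpa using hx),
        ← eq_C_of_degree_le_zero (by simpa using hy)]⟩
  · rintro ⟨x, y, rfl⟩
    exact ⟨C x, C y, by simpa using degree_C_le, by simpa using degree_C_le, rfl⟩

theorem finite_Sset_zero (c d : Polynomial Fq) : (Sset Fq c d 0).Finite := by
  refine (Set.finite_range fun p : Fq × Fq => C p.1 * c + C p.2 * d).subset fun z hz => ?_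
  obtain ⟨x, y, rfl⟩ := mem_Sset_zero.1 hz
  exact ⟨(x, y), rfl⟩

theorem le_tcd_zero {c d : Polynomial Fq} (S' : Finset (Polynomial Fq))
    (hS : ↑S' ⊆ Sset Fq c d 0) (hco : ∀ a ∈ S', ∀ b ∈ S', a ≠ b → IsCoprime a b) :
    S'.card ≤ tcd Fq c d 0 := by
  refine le_csSup ⟨(finite_Sset_zero Fq c d).toFinset.card, ?_⟩ ⟨S', hS, hco, rfl⟩
  rintro _ ⟨T, hT, -, rfl⟩
  exact Finset.card_le_card fun z hz => (finite_Sset_zero Fq c d).mem_toFinset.2 (hT hz)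

/-- Representatives of the points of the projective line spanned by `c` and `d`. -/
def lineRep (c d : Polynomial Fq) : Option Fq → Polynomial Fq
  | none => c
  | some r => C r * c + d

theorem isCoprime_lineRep {F : Type} [Field F] {c d : Polynomial F} (h : IsCoprime c d)
    {i j : Option F} (hij : i ≠ j) : IsCoprime (lineRep F c d i) (lineRep F c d j) := by
  have key : ∀ r : F, IsCoprime c (C r * c + d) := fun r => by
    rw [add_comm, mul_comm]
    exact h.add_mul_left_right _
  match i, j with
  | none, none => exact absurd rfl hij
  | none, some r => exact key r
  | some r, none => exact (key r).symm
  | some r, some s =>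
    have hrs : s - r ≠ 0 := sub_ne_zero.2 fun e => hij (by rw [e])
    have h1 : IsCoprime (C r * c + d) (C (s - r) * c) :=
      (isCoprime_mul_unit_left_right ((isUnit_C).2 hrs.isUnit) _ _).2 (key r).symm
    have h2 : C s * c + d = C (s - r) * c + (C r * c + d) * 1 := by
      rw [C_sub]
      ring
    change IsCoprime (C r * c + d) (C s * c + d)
    rw [h2]
    exact h1.add_mul_left_right 1

theorem lineRep_injective {F : Type} [Field F] {c d : Polynomial F} (h : IsCoprime c d)
    (hdeg : 0 < max c.degree d.degree) : Function.Injective (lineRep F c d) := by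
  intro i j hij
  have hc : c ≠ 0 := by
    rintro rfl
    have hd := degree_eq_zero_of_isUnit (isCoprime_zero_left.1 h)
    simp [hd] at hdeg
  have hne : ∀ r : F, c ≠ C r * c + d := fun r e => by
    have hd : d = C (1 - r) * c := by
      rw [C_sub, C_1]
      linear_combination -e
    have hu : IsUnit c := h.isUnit_of_dvd' dvd_rfl ⟨C (1 - r), by rw [hd, mul_comm]⟩
    have hdd : d.degree ≤ 0 := by
      rw [hd, degree_mul, degree_eq_zero_of_isUnit hu, add_zero]
      exact degree_C_le
    exact absurd hdeg (not_lt.2 (max_le (degree_eq_zero_of_isUnit hu).le hdd))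
  match i, j with
  | none, none => rfl
  | none, some r => exact absurd hij (hne r)
  | some r, none => exact absurd hij.symm (hne r)
  | some r, some s => rw [C_injective (mul_right_cancel₀ hc (add_right_cancel hij))]

theorem card_add_one_le_tcd_zero {c d : Polynomial Fq} (h : IsCoprime c d)
    (hdeg : 0 < max c.degree d.degree) : Fintype.card Fq + 1 ≤ tcd Fq c d 0 := by
  classical
  have hinj := lineRep_injective h hdeg
  have hcard : (Finset.univ.image (lineRep Fq c d)).card = Fintype.card Fq + 1 := by
    rw [Finset.card_image_of_injective _ hinj, Finset.card_univ, Fintype.card_option]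
  rw [← hcard]
  refine le_tcd_zero Fq _ ?_ ?_
  · intro z hz
    obtain ⟨i, -, rfl⟩ := Finset.mem_image.1 (Finset.mem_coe.1 hz)
    refine mem_Sset_zero.2 ?_
    cases i with
    | none => exact ⟨1, 0, by simp [lineRep]⟩
    | some r => exact ⟨r, 1, by simp [lineRep]⟩
  · intro a ha b hb hab
    obtain ⟨i, -, rfl⟩ := Finset.mem_image.1 ha
    obtain ⟨j, -, rfl⟩ := Finset.mem_image.1 hb
    exact isCoprime_lineRep h fun e => hab (by rw [e])

open Classical in
theorem tcd_X_sq_X_add_one_le : tcd Fq (X ^ 2) (X + 1) 0 ≤ Fintype.card Fq + 1 := by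
  refine csSup_le ⟨0, ∅, by simp, by simp, by simp⟩ ?_
  rintro _ ⟨S', hS, hco, rfl⟩
  rw [← Fintype.card_option, ← Finset.card_univ]
  refine Finset.card_le_card_of_injOn
    (fun z => if z.coeff 0 = 0 then none else some (z.coeff 2 / z.coeff 0))
    (fun _ _ => Finset.mem_coe.2 (Finset.mem_univ _)) ?_
  intro a ha b hb hab
  by_contra hne
  have hcop := hco a ha b hb hne
  obtain ⟨x, y, rfl⟩ := mem_Sset_zero.1 (hS ha)
  obtain ⟨u, v, rfl⟩ := mem_Sset_zero.1 (hS hb)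
  have h0 : ∀ s t : Fq, (C s * X ^ 2 + C t * (X + 1) : Polynomial Fq).coeff 0 = t :=
    fun s t => by simp
  have h2 : ∀ s t : Fq, (C s * X ^ 2 + C t * (X + 1) : Polynomial Fq).coeff 2 = s :=
    fun s t => by simp [coeff_X, coeff_one]
  simp only [h0, h2] at hab
  by_cases hy : y = 0 <;> by_cases hv : v = 0
  · subst hy hv
    have := hcop.isUnit_of_dvd' (x := (X : Polynomial Fq)) ⟨C x * X, by simp; ring⟩
      ⟨C u * X, by simp; ring⟩
    exact not_isUnit_X this
  · simp [hy, hv] at hab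
  · simp [hy, hv] at hab
  · simp only [hy, hv, if_false, Option.some.injEq] at hab
    have hfac : ∀ s t : Fq, t ≠ 0 → (C (s / t) * X ^ 2 + (X + 1) : Polynomial Fq) ∣
        C s * X ^ 2 + C t * (X + 1) := fun s t ht => ⟨C t, by
      have : (C s : Polynomial Fq) = C (s / t) * C t := by rw [← C_mul, div_mul_cancel₀ _ ht]
      rw [this]
      ring⟩
    have hunit := hcop.isUnit_of_dvd' (hfac x y hy) (hab ▸ hfac u v hv)
    have h1 := congrArg (coeff · 1) (eq_C_of_degree_eq_zero (degree_eq_zero_of_isUnit hunit))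
    simp [coeff_one] at h1

/-- For every integer `n ≥ 3`, one has `t(0, n) = q + 1`. -/
theorem tmn_zero_eq
    (Fq : Type) [Field Fq] [Fintype Fq]
    (n : ℕ) (hn : 3 ≤ n) :
    tmn Fq 0 n = ((Fintype.card Fq + 1 : ℕ) : ℕ∞) := by
  apply le_antisymm
  · have hle : tmn Fq 0 n ≤ tcd Fq (X ^ 2) (X + 1) 0 := by
      refine sInf_le ⟨X ^ 2, X + 1, ⟨1, 1 - X, by ring⟩, ?_, ?_, rfl⟩
      · refine lt_max_of_lt_left ?_
        rw [degree_X_pow]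
        norm_num
      · rw [degree_X_pow, ← C_1, degree_X_add_C]
        refine max_lt ?_ ?_ <;> norm_cast
        omega
    exact hle.trans (Nat.cast_le.2 (tcd_X_sq_X_add_one_le Fq))
  · refine le_sInf ?_
    rintro _ ⟨c, d, hcd, hlow, -, rfl⟩
    refine Nat.cast_le.2 (card_add_one_le_tcd_zero Fq hcd (lt_trans ?_ hlow))
    norm_num
end SturmFF
end
end

section
/- If 𝔫 ∈ A₊ has at most q distinct monic prime factors, i.e. t(𝔫) ≤ q, then τ(𝔫) = 0. -/
open Polynomial Matrix

noncomputable section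

namespace SturmFF

variable (Fq : Type) [Field Fq] [Fintype Fq]

/-- If `c` and `d` are coprime, not both constant, then `c` together with the polynomials
`d + x c` for `x : Fq` are `q + 1` pairwise coprime elements of `S(c,d;0)`. -/
theorem card_lt_tcd_zero {c d : Polynomial Fq} (hcd : IsCoprime c d)
    (hdeg : 0 < max c.degree d.degree) : Fintype.card Fq < tcd Fq c d 0 := by
  classical
  have hcop (x : Fq) : IsCoprime c (d + C x * c) := hcd.add_mul_right_right _
  have hc0 : c ≠ 0 := by
    rintro rfl
    have hd := degree_eq_zero_of_isUnit (isCoprime_zero_left.mp hcd)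
    simp [hd] at hdeg
  have hne (x : Fq) : c ≠ d + C x * c := by
    intro h
    have hcx := hcop x
    rw [← h] at hcx
    have hcu : IsUnit c := isCoprime_self.mp hcx
    have hd : d = C (1 - x) * c := by
      rw [C_sub, C_1]
      linear_combination -h
    have hc := degree_eq_zero_of_isUnit hcu
    have hd' : d.degree ≤ 0 := by
      rw [hd, degree_mul, hc, add_zero]
      exact degree_C_le
    simp [hc, hd'.not_gt] at hdeg
  have hinj : Function.Injective fun x : Fq => d + C x * c := fun x y hxy =>
    C_injective (mul_right_cancel₀ hc0 (add_left_cancel hxy))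
  have hdd (x y : Fq) (hxy : x ≠ y) : IsCoprime (d + C x * c) (d + C y * c) := by
    have hu : IsUnit (C (y - x)) := isUnit_C.mpr (sub_ne_zero.mpr hxy.symm).isUnit
    have h := ((isCoprime_mul_unit_left_right hu (d + C x * c) c).mpr
      (hcop x).symm).add_mul_left_right 1
    rwa [show C (y - x) * c + (d + C x * c) * 1 = d + C y * c by rw [C_sub]; ring] at h
  have hfin : (Sset Fq c d 0).Finite := by
    refine (Set.finite_range fun p : Fq × Fq => C p.1 * c + C p.2 * d).subset ?_
    rintro z ⟨x, y, hx, hy, rfl⟩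
    refine ⟨(x.coeff 0, y.coeff 0), ?_⟩
    simp only [← eq_C_of_degree_le_zero hx, ← eq_C_of_degree_le_zero hy]
  refine Nat.lt_of_succ_le (le_csSup ⟨(Sset Fq c d 0).ncard, ?_⟩
    ⟨insert c (Finset.univ.image fun x : Fq => d + C x * c), ?_, ?_, ?_⟩)
  · rintro _ ⟨S', hS', -, rfl⟩
    rw [← Set.ncard_coe_finset]
    exact Set.ncard_le_ncard hS' hfin
  · intro z hz
    simp only [Finset.coe_insert, Finset.coe_image, Finset.coe_univ, Set.image_univ,
      Set.mem_insert_iff, Set.mem_range] at hz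
    rcases hz with rfl | ⟨x, rfl⟩
    · exact ⟨1, 0, by simp, by simp, by simp⟩
    · exact ⟨C x, 1, degree_C_le, by simp, by ring⟩
  · intro a ha b hb hab
    simp only [Finset.mem_insert, Finset.mem_image, Finset.mem_univ, true_and] at ha hb
    rcases ha with rfl | ⟨x, rfl⟩ <;> rcases hb with rfl | ⟨y, rfl⟩
    · exact absurd rfl hab
    · exact hcop y
    · exact (hcop x).symm
    · exact hdd x y fun h => hab (h ▸ rfl)
  · rw [Finset.card_insert_of_notMem, Finset.card_image_of_injective _ hinj, Finset.card_univ]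
    simpa using fun x => (hne x).symm

/-- If `𝔫` has at most `q` distinct monic prime factors, then `τ(𝔫) = 0`. -/
theorem tau_eq_zero
    (Fq : Type) [Field Fq] [Fintype Fq]
    (𝔫 : Polynomial Fq) (h𝔫 : 𝔫.Monic)
    (ht : tPrimes Fq 𝔫 ≤ Fintype.card Fq) :
    tauN Fq 𝔫 = 0 := by
  refine Nat.sInf_eq_zero.mpr (Or.inl ?_)
  refine lt_of_lt_of_le (b := ((Fintype.card Fq + 1 : ℕ) : ℕ∞))
    (Nat.cast_lt.mpr (Nat.lt_succ_of_le ht)) (le_sInf ?_)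
  rintro _ ⟨c, d, hcd, hlow, -, rfl⟩
  refine Nat.cast_le.mpr (card_lt_tcd_zero Fq hcd (lt_trans ?_ hlow))
  simp
end SturmFF
end
end
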